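/- The optimal winning probability V_n in Levine's hat game (the limit as h → ∞ of the finite-stack optimal probabilities V_{n,h}) equals the supremum over measurable functions k₁,…,kₙ : [0,1)^{n-1} → ℕ* of ∫_{[0,1]^n} ∏_{i=1}^n ε(2^{kᵢ(x_{-i})} xᵢ) dΛ^n. -/

import Mathlib

open MeasureTheory Filter

/-- `ε(t) = ⌊t⌋ - 2⌊t/2⌋`, the parity of `⌊t⌋`. -/
noncomputable def eps (t : ℝ) : ℝ := (⌊t⌋ : ℝ) - 2 * (⌊t / 2⌋ : ℝ)

open Classical in
/-- `V_{n,h}`: the optimal winning probability in the Levine hat game with `n` players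
and finite stacks of `h` hats; strategies for player `i` map the other players' stacks
to an index in `{1,…,h}` (here `Fin h`), and the `(2^h)^n` hat configurations are
equiprobable. -/
noncomputable def Vnh (n h : ℕ) : ℝ :=
  sSup {p : ℝ | ∃ k : (i : Fin n) → (({j : Fin n // j ≠ i} → (Fin h → Bool)) → Fin h),
    p = ((Finset.univ.filter (fun u : Fin n → (Fin h → Bool) =>
            ∀ i : Fin n, u i (k i (fun j => u j.1)) = true)).card : ℝ) / ((2 ^ h) ^ n : ℕ)}

/-- first `h` binary digits -/
noncomputable def hatD (h : ℕ) (x : ℝ) : Fin h → Bool := fun j => ⌊(2 : ℝ) ^ h * x⌋₊.testBit j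

/-- dyadic point coding a stack -/
noncomputable def hatP (h : ℕ) (u : Fin h → Bool) : ℝ := (Nat.ofBits u : ℝ) / 2 ^ h

lemma hatP_nonneg (h : ℕ) (u : Fin h → Bool) : 0 ≤ hatP h u := by
  unfold hatP; positivity

lemma hatP_add_le (h : ℕ) (u : Fin h → Bool) : hatP h u + ((2 : ℝ) ^ h)⁻¹ ≤ 1 := by
  have h1 : (Nat.ofBits u : ℝ) + 1 ≤ 2 ^ h := by exact_mod_cast Nat.ofBits_lt_two_pow u
  have h2 : (0 : ℝ) < 2 ^ h := by positivity
  unfold hatP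
  rw [inv_eq_one_div, ← add_div, div_le_one h2]
  exact h1

lemma hatD_add (h : ℕ) (u : Fin h → Bool) (y : ℝ) (h0 : 0 ≤ y) (h1 : y < ((2 : ℝ) ^ h)⁻¹) :
    hatD h (y + hatP h u) = u := by
  have h2 : (0 : ℝ) < 2 ^ h := by positivity
  have h3 : (2 : ℝ) ^ h * y < 1 := by
    rwa [← lt_div_iff₀' h2, one_div]
  have hf : ⌊(2 : ℝ) ^ h * (y + hatP h u)⌋₊ = Nat.ofBits u := by
    have : (2 : ℝ) ^ h * (y + hatP h u) = 2 ^ h * y + Nat.ofBits u := by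
      unfold hatP; field_simp
    rw [this, Nat.floor_add_natCast (by positivity), Nat.floor_eq_zero.2 h3, zero_add]
  funext j
  simp [hatD, hf]

lemma hatP_hatD (h : ℕ) (x : ℝ) (h0 : 0 ≤ x) (h1 : x < 1) :
    hatP h (hatD h x) ≤ x ∧ x < hatP h (hatD h x) + ((2 : ℝ) ^ h)⁻¹ := by
  have h2 : (0 : ℝ) < 2 ^ h := by positivity
  have hlt : ⌊(2 : ℝ) ^ h * x⌋₊ < 2 ^ h := by
    rw [Nat.floor_lt (by positivity)]
    push_cast
    nlinarith
  have hb : Nat.ofBits (hatD h x) = ⌊(2 : ℝ) ^ h * x⌋₊ := by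
    unfold hatD
    rw [Nat.ofBits_testBit, Nat.mod_eq_of_lt hlt]
  have ha := Nat.floor_le (a := (2 : ℝ) ^ h * x) (by positivity)
  have hc := Nat.lt_floor_add_one ((2 : ℝ) ^ h * x)
  unfold hatP
  rw [hb, inv_eq_one_div, ← add_div, div_le_iff₀ h2, lt_div_iff₀ h2]
  constructor <;> linarith

lemma eps_floor (t : ℝ) (ht : 0 ≤ t) : eps t = ((⌊t⌋₊ % 2 : ℕ) : ℝ) := by
  unfold eps
  rw [← natCast_floor_eq_intCast_floor ht, ← natCast_floor_eq_intCast_floor (by positivity),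
    Nat.floor_div_ofNat]
  have := Nat.mod_add_div ⌊t⌋₊ 2
  have h2 : ((⌊t⌋₊ % 2 : ℕ) : ℝ) + 2 * ((⌊t⌋₊ / 2 : ℕ) : ℝ) = ⌊t⌋₊ := by exact_mod_cast this
  have h3 : ((⌊t⌋₊ / OfNat.ofNat 2 : ℕ) : ℝ) = ((⌊t⌋₊ / 2 : ℕ) : ℝ) := rfl
  linarith

lemma eps_hat (h : ℕ) (x : ℝ) (h0 : 0 ≤ x) (j : Fin h) :
    eps ((2 : ℝ) ^ (h - j.1) * x) = if hatD h x j = true then 1 else 0 := by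
  rw [eps_floor _ (by positivity)]
  have : (2 : ℝ) ^ (h - j.1) * x = (2 : ℝ) ^ h * x / ((2 ^ j.1 : ℕ) : ℝ) := by
    rw [pow_sub₀ _ (by norm_num) j.2.le]
    push_cast
    field_simp
  rw [this, Nat.floor_div_natCast]
  unfold hatD
  rw [Nat.testBit_eq_decide_div_mod_eq]
  rcases Nat.mod_two_eq_zero_or_one (⌊(2 : ℝ) ^ h * x⌋₊ / 2 ^ j.1) with h | h <;> simp [h]

lemma eps_mem (t : ℝ) (ht : 0 ≤ t) : 0 ≤ eps t ∧ eps t ≤ 1 := by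
  rw [eps_floor t ht]
  refine ⟨by positivity, ?_⟩
  have := Nat.mod_lt ⌊t⌋₊ (show 2 > 0 by norm_num)
  exact_mod_cast (by omega : ⌊t⌋₊ % 2 ≤ 1)

lemma measurable_eps : Measurable eps := by
  unfold eps
  have h1 : Measurable (fun z : ℤ => (z : ℝ)) := measurable_from_top
  exact (h1.comp Int.measurable_floor).sub
    ((h1.comp (Int.measurable_floor.comp (measurable_id.div_const 2))).const_mul 2)

lemma measurable_hatD (h : ℕ) : Measurable (hatD h) := by
  rw [measurable_pi_iff]
  intro j
  have h1 : Measurable (fun m : ℕ => m.testBit j) := measurable_from_top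
  exact h1.comp (Nat.measurable_floor.comp (measurable_id.const_mul _))

/-- the basic small cube -/
def hatB (n h : ℕ) : Set (Fin n → ℝ) := Set.univ.pi fun _ => Set.Ico (0 : ℝ) ((2 : ℝ) ^ h)⁻¹

lemma measurableSet_hatB (n h : ℕ) : MeasurableSet (hatB n h) :=
  MeasurableSet.univ_pi fun _ => measurableSet_Ico

lemma volume_hatB (n h : ℕ) : volume.real (hatB n h) = (((2 ^ h) ^ n : ℕ) : ℝ)⁻¹ := by
  unfold hatB Measure.real
  rw [volume_pi_pi]
  simp

/-- the shift of a configuration -/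
noncomputable def hatS (n h : ℕ) (u : Fin n → Fin h → Bool) : Fin n → ℝ := fun i => hatP h (u i)

lemma hatB_decode {n h : ℕ} {y : Fin n → ℝ} (hy : y ∈ hatB n h) (u : Fin n → Fin h → Bool)
    (i : Fin n) : hatD h ((y + hatS n h u) i) = u i :=
  hatD_add h (u i) (y i) (hy i trivial).1 (hy i trivial).2

lemma hatB_nonneg {n h : ℕ} {y : Fin n → ℝ} (hy : y ∈ hatB n h) (u : Fin n → Fin h → Bool)
    (i : Fin n) : 0 ≤ (y + hatS n h u) i :=
  add_nonneg (hy i trivial).1 (hatP_nonneg _ _)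

lemma cube_union (n h : ℕ) : (Set.univ.pi fun _ : Fin n => Set.Ico (0 : ℝ) 1) =
    ⋃ u : Fin n → Fin h → Bool, (fun y => y + hatS n h u) '' hatB n h := by
  ext x
  simp only [Set.mem_iUnion, Set.mem_image]
  constructor
  · intro hx
    refine ⟨fun i => hatD h (x i), fun i => x i - hatP h (hatD h (x i)), ?_, ?_⟩
    · intro i _
      have := hatP_hatD h (x i) (hx i trivial).1 (hx i trivial).2
      constructor <;> simp only <;> linarith [this.1, this.2]
    · funext i; simp [hatS]
  · rintro ⟨u, y, hy, rfl⟩ i _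
    refine ⟨hatB_nonneg hy u i, ?_⟩
    have := hatP_add_le h (u i)
    have := (hy i trivial).2
    show y i + hatP h (u i) < 1
    linarith

lemma cube_integral (n h : ℕ) (F : (Fin n → ℝ) → ℝ)
    (hF : IntegrableOn F (Set.univ.pi fun _ : Fin n => Set.Icc (0 : ℝ) 1)) :
    (∀ u : Fin n → Fin h → Bool, IntegrableOn (fun y => F (y + hatS n h u)) (hatB n h)) ∧
    ∫ x in Set.univ.pi (fun _ : Fin n => Set.Icc (0 : ℝ) 1), F x =
      ∫ y in hatB n h, ∑ u : Fin n → Fin h → Bool, F (y + hatS n h u) := by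
  have hmp : ∀ v : Fin n → ℝ, MeasurePreserving (fun y : Fin n → ℝ => y + v) volume volume :=
    fun v => measurePreserving_add_right volume v
  have hme : ∀ v : Fin n → ℝ, MeasurableEmbedding (fun y : Fin n → ℝ => y + v) :=
    fun v => measurableEmbedding_addRight v
  have hae : (Set.univ.pi fun _ : Fin n => Set.Ico (0 : ℝ) 1) =ᵐ[volume]
      (Set.univ.pi fun _ : Fin n => Set.Icc (0 : ℝ) 1) :=
    Measure.pi_Ico_ae_eq_pi_Icc (μ := fun _ => volume)
  have hF' : IntegrableOn F (Set.univ.pi fun _ : Fin n => Set.Ico (0 : ℝ) 1) :=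
    hF.congr_set_ae hae
  have hFu : ∀ u : Fin n → Fin h → Bool,
      IntegrableOn F ((fun y => y + hatS n h u) '' hatB n h) := by
    intro u
    refine hF'.mono_set ?_
    rw [cube_union n h]
    exact Set.subset_iUnion (fun u => (fun y => y + hatS n h u) '' hatB n h) u
  have hint : ∀ u : Fin n → Fin h → Bool,
      IntegrableOn (fun y => F (y + hatS n h u)) (hatB n h) := by
    intro u
    exact ((hmp (hatS n h u)).integrableOn_image (hme _)).1 (hFu u)
  refine ⟨hint, ?_⟩
  rw [← setIntegral_congr_set hae, cube_union n h, integral_iUnion_fintype _ _ hFu,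
    integral_finsetSum _ (fun u _ => hint u)]
  · refine Finset.sum_congr rfl fun u _ => ?_
    exact (hmp (hatS n h u)).setIntegral_image_emb (hme _) F (hatB n h)
  · intro u
    exact (hme _).measurableSet_image.2 (measurableSet_hatB n h)
  · intro u v huv
    refine Set.disjoint_left.2 ?_
    rintro x ⟨y, hy, rfl⟩ ⟨z, hz, hzy⟩
    apply huv
    funext i
    rw [← hatB_decode hy u i, ← hatB_decode hz v i]
    exact (congrArg (hatD h) (congrFun hzy i)).symm

open Classical in
lemma Vnh_bdd (n h : ℕ) : BddAbove {p : ℝ | ∃ k : (i : Fin n) →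
      (({j : Fin n // j ≠ i} → (Fin h → Bool)) → Fin h),
    p = ((Finset.univ.filter (fun u : Fin n → (Fin h → Bool) =>
            ∀ i : Fin n, u i (k i (fun j => u j.1)) = true)).card : ℝ) / ((2 ^ h) ^ n : ℕ)} :=
  (Set.finite_range (fun k : (i : Fin n) →
      (({j : Fin n // j ≠ i} → (Fin h → Bool)) → Fin h) =>
    ((Finset.univ.filter (fun u : Fin n → (Fin h → Bool) =>
            ∀ i : Fin n, u i (k i (fun j => u j.1)) = true)).card : ℝ) /
              ((2 ^ h) ^ n : ℕ))).bddAbove.mono (by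
    rintro p ⟨k, rfl⟩
    exact ⟨k, rfl⟩)

/-- the integrand -/
noncomputable def hatF {n : ℕ} (k : (i : Fin n) → (({j : Fin n // j ≠ i} → ℝ) → ℕ))
    (x : Fin n → ℝ) : ℝ := ∏ i : Fin n, eps ((2 : ℝ) ^ (k i (fun j => x j.1)) * x i)

lemma measurable_hatk {n : ℕ} {k : (i : Fin n) → (({j : Fin n // j ≠ i} → ℝ) → ℕ)}
    (hk : ∀ i, Measurable (k i)) (i : Fin n) :
    Measurable (fun x : Fin n → ℝ => k i (fun j => x j.1)) :=
  (hk i).comp (measurable_pi_lambda _ fun j => measurable_pi_apply j.1)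

lemma measurable_hatF {n : ℕ} {k : (i : Fin n) → (({j : Fin n // j ≠ i} → ℝ) → ℕ)}
    (hk : ∀ i, Measurable (k i)) : Measurable (hatF k) := by
  unfold hatF
  refine Finset.measurable_fun_prod _ fun i _ => measurable_eps.comp ?_
  have h1 : Measurable (fun m : ℕ => (2 : ℝ) ^ m) := measurable_from_top
  exact (h1.comp (measurable_hatk hk i)).mul (measurable_pi_apply i)

lemma hatF_mem {n : ℕ} (k : (i : Fin n) → (({j : Fin n // j ≠ i} → ℝ) → ℕ))
    (x : Fin n → ℝ) (hx : ∀ i, 0 ≤ x i) : 0 ≤ hatF k x ∧ hatF k x ≤ 1 := by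
  have : ∀ i, 0 ≤ (2 : ℝ) ^ (k i (fun j => x j.1)) * x i := fun i =>
    mul_nonneg (by positivity) (hx i)
  exact ⟨Finset.prod_nonneg fun i _ => (eps_mem _ (this i)).1,
    Finset.prod_le_one (fun i _ => (eps_mem _ (this i)).1) fun i _ => (eps_mem _ (this i)).2⟩

lemma integrable_cube {n : ℕ} {G : (Fin n → ℝ) → ℝ} (hG : Measurable G)
    (hb : ∀ x : Fin n → ℝ, (∀ i, 0 ≤ x i) → 0 ≤ G x ∧ G x ≤ 1) :
    IntegrableOn G (Set.univ.pi fun _ : Fin n => Set.Icc (0 : ℝ) 1) := by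
  have hms : MeasurableSet (Set.univ.pi fun _ : Fin n => Set.Icc (0 : ℝ) 1) :=
    MeasurableSet.univ_pi fun _ => measurableSet_Icc
  refine Measure.integrableOn_of_bounded (M := 1) ?_ hG.aestronglyMeasurable ?_
  · rw [volume_pi_pi]; simp
  · filter_upwards [ae_restrict_mem hms] with x hx
    have := hb x fun i => (hx i trivial).1
    rw [Real.norm_eq_abs, abs_le]
    constructor <;> linarith [this.1, this.2]

open Classical in
/-- the truncated integrand -/
noncomputable def hatT {n : ℕ} (h : ℕ) (k : (i : Fin n) → (({j : Fin n // j ≠ i} → ℝ) → ℕ))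
    (x : Fin n → ℝ) : ℝ := if ∀ i, k i (fun j => x j.1) ≤ h then hatF k x else 0

lemma measurable_hatT {n : ℕ} (h : ℕ) {k : (i : Fin n) → (({j : Fin n // j ≠ i} → ℝ) → ℕ)}
    (hk : ∀ i, Measurable (k i)) : Measurable (hatT h k) := by
  unfold hatT
  refine Measurable.ite ?_ (measurable_hatF hk) measurable_const
  rw [Set.ofPred_forall]
  exact MeasurableSet.iInter fun i => measurableSet_le (measurable_hatk hk i) measurable_const

lemma hatT_mem {n : ℕ} (h : ℕ) (k : (i : Fin n) → (({j : Fin n // j ≠ i} → ℝ) → ℕ))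
    (x : Fin n → ℝ) (hx : ∀ i, 0 ≤ x i) : 0 ≤ hatT h k x ∧ hatT h k x ≤ 1 := by
  unfold hatT
  split_ifs
  · exact hatF_mem k x hx
  · norm_num

lemma prod_ite_all {n : ℕ} (p : Fin n → Prop) [DecidablePred p] [Decidable (∀ i, p i)] :
    (∏ i, if p i then (1 : ℝ) else 0) = if ∀ i, p i then 1 else 0 := by
  rw [Finset.prod_ite_zero]
  simp

lemma hatT_sum_le {n h : ℕ} (hh : 1 ≤ h) (k : (i : Fin n) → (({j : Fin n // j ≠ i} → ℝ) → ℕ))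
    (hk1 : ∀ i x, 1 ≤ k i x) {y : Fin n → ℝ} (hy : y ∈ hatB n h) :
    ∑ u : Fin n → Fin h → Bool, hatT h k (y + hatS n h u) ≤ Vnh n h * ((2 ^ h) ^ n : ℕ) := by
  classical
  let K : (i : Fin n) → (({j : Fin n // j ≠ i} → (Fin h → Bool)) → Fin h) := fun i w =>
    ⟨h - k i (fun j => y j.1 + hatP h (w j)), by
      have := hk1 i (fun j => y j.1 + hatP h (w j))
      omega⟩
  have hV : ((Finset.univ.filter (fun u : Fin n → (Fin h → Bool) =>
            ∀ i : Fin n, u i (K i (fun j => u j.1)) = true)).card : ℝ) / ((2 ^ h) ^ n : ℕ)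
      ≤ Vnh n h := by
    refine le_csSup (Vnh_bdd n h) ⟨K, ?_⟩
    congr!
  rw [div_le_iff₀ (by positivity)] at hV
  refine le_trans ?_ hV
  rw [Finset.card_filter]
  push_cast
  refine Finset.sum_le_sum fun u _ => ?_
  unfold hatT
  split_ifs with h1 h2 h2
  · exact (hatF_mem k _ (hatB_nonneg hy u)).2
  · push Not at h2
    obtain ⟨i, hi⟩ := h2
    refine le_of_eq (Finset.prod_eq_zero (Finset.mem_univ i) ?_)
    have hki := h1 i
    have e : k i (fun j => (y + hatS n h u) j.1) = h - (K i (fun j => u j.1)).1 := by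
      show _ = h - (h - k i (fun j => (y + hatS n h u) j.1))
      omega
    rw [e, eps_hat h _ (hatB_nonneg hy u i), hatB_decode hy u i, if_neg hi]
  · norm_num
  · exact le_rfl

lemma hatT_int_le {n h : ℕ} (hh : 1 ≤ h) (k : (i : Fin n) → (({j : Fin n // j ≠ i} → ℝ) → ℕ))
    (hk : ∀ i, Measurable (k i)) (hk1 : ∀ i x, 1 ≤ k i x) :
    ∫ x in Set.univ.pi (fun _ : Fin n => Set.Icc (0 : ℝ) 1), hatT h k x ≤ Vnh n h := by
  obtain ⟨h1, h2⟩ := cube_integral n h (hatT h k)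
    (integrable_cube (measurable_hatT h hk) (hatT_mem h k))
  rw [h2]
  have hfin : volume (hatB n h) ≠ ⊤ := by
    unfold hatB; rw [volume_pi_pi]; simp
  calc _ ≤ ∫ y in hatB n h, Vnh n h * ((2 ^ h) ^ n : ℕ) := by
        refine setIntegral_mono_on (integrable_finsetSum _ fun u _ => h1 u)
          (integrableOn_const hfin) (measurableSet_hatB n h) fun y hy => hatT_sum_le hh k hk1 hy
    _ = Vnh n h := by
        rw [setIntegral_const, volume_hatB, smul_eq_mul]
        have : (((2 ^ h) ^ n : ℕ) : ℝ) ≠ 0 := by positivity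
        field_simp

lemma hatT_tendsto {n : ℕ} (k : (i : Fin n) → (({j : Fin n // j ≠ i} → ℝ) → ℕ))
    (hk : ∀ i, Measurable (k i)) :
    Tendsto (fun h => ∫ x in Set.univ.pi (fun _ : Fin n => Set.Icc (0 : ℝ) 1), hatT h k x) atTop
      (nhds (∫ x in Set.univ.pi (fun _ : Fin n => Set.Icc (0 : ℝ) 1), hatF k x)) := by
  have hms : MeasurableSet (Set.univ.pi fun _ : Fin n => Set.Icc (0 : ℝ) 1) :=
    MeasurableSet.univ_pi fun _ => measurableSet_Icc
  refine tendsto_integral_of_dominated_convergence (fun _ => 1)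
    (fun h => (measurable_hatT h hk).aestronglyMeasurable) ?_ ?_ ?_
  · refine integrableOn_const ?_
    rw [volume_pi_pi]; simp
  · intro h
    filter_upwards [ae_restrict_mem hms] with x hx
    have := hatT_mem h k x fun i => (hx i trivial).1
    rw [Real.norm_eq_abs, abs_le]
    constructor <;> linarith [this.1, this.2]
  · refine Eventually.of_forall fun x => ?_
    refine tendsto_const_nhds.congr' ?_
    filter_upwards [eventually_ge_atTop (∑ i, k i (fun j => x j.1))] with h hh
    unfold hatT
    rw [if_pos]
    intro i
    exact (Finset.single_le_sum (f := fun i => k i (fun j => x j.1)) (fun _ _ => Nat.zero_le _)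
      (Finset.mem_univ i)).trans hh

open Classical in
lemma finite_strategy {n h : ℕ}
    (k : (i : Fin n) → (({j : Fin n // j ≠ i} → (Fin h → Bool)) → Fin h)) :
    ∃ K : (i : Fin n) → (({j : Fin n // j ≠ i} → ℝ) → ℕ),
      (∀ i, Measurable (K i)) ∧ (∀ i x, 1 ≤ K i x) ∧
      ((Finset.univ.filter (fun u : Fin n → (Fin h → Bool) =>
            ∀ i : Fin n, u i (k i (fun j => u j.1)) = true)).card : ℝ) / ((2 ^ h) ^ n : ℕ)
        = ∫ x in Set.univ.pi (fun _ : Fin n => Set.Icc (0 : ℝ) 1), hatF K x := by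
  let K : (i : Fin n) → (({j : Fin n // j ≠ i} → ℝ) → ℕ) :=
    fun i x => h - (k i (fun j => hatD h (x j))).1
  have hK : ∀ i, Measurable (K i) := by
    intro i
    have h1 : Measurable (fun w : {j : Fin n // j ≠ i} → (Fin h → Bool) => h - (k i w).1) :=
      measurable_of_countable _
    exact h1.comp (measurable_pi_lambda _ fun j => (measurable_hatD h).comp (measurable_pi_apply j))
  refine ⟨K, hK, fun i x => ?_, ?_⟩
  · have := (k i (fun j => hatD h (x j))).2
    show 1 ≤ h - (k i (fun j => hatD h (x j))).1
    omega
  · rw [(cube_integral n h (hatF K) (integrable_cube (measurable_hatF hK) (hatF_mem K))).2]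
    have : ∀ y ∈ hatB n h, ∑ u : Fin n → Fin h → Bool, hatF K (y + hatS n h u) =
        ((Finset.univ.filter (fun u : Fin n → (Fin h → Bool) =>
            ∀ i : Fin n, u i (k i (fun j => u j.1)) = true)).card : ℝ) := by
      intro y hy
      rw [Finset.card_filter]
      push_cast
      refine Finset.sum_congr rfl fun u _ => ?_
      rw [← prod_ite_all]
      refine Finset.prod_congr rfl fun i _ => ?_
      have e : K i (fun j => (y + hatS n h u) j.1) = h - (k i (fun j => u j.1)).1 := by
        show h - (k i (fun j => hatD h ((y + hatS n h u) j.1))).1 = _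
        simp only [hatB_decode hy u]
      rw [e, eps_hat h _ (hatB_nonneg hy u i), hatB_decode hy u i]
    rw [setIntegral_congr_fun (measurableSet_hatB n h) this, setIntegral_const, volume_hatB,
      smul_eq_mul, div_eq_inv_mul]


/-- The optimal winning probability `V_n = lim_{h→∞} V_{n,h}` of Levine's hat game equals
the supremum, over measurable functions `kᵢ` of the other players' stacks (encoded as
reals) with values in `ℕ* = {k ≥ 1}`, of `∫_{[0,1]^n} ∏ᵢ ε(2^{kᵢ(x_{-i})} xᵢ) dΛⁿ`. -/
theorem Vn_eq_integral_sup (n : ℕ) (hn : 1 ≤ n) (V : ℝ)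
    (hV : Tendsto (fun h => Vnh n h) atTop (nhds V)) :
    V = sSup {p : ℝ | ∃ k : (i : Fin n) → (({j : Fin n // j ≠ i} → ℝ) → ℕ),
      (∀ i, Measurable (k i)) ∧ (∀ i x, 1 ≤ k i x) ∧
      p = ∫ x in Set.univ.pi (fun _ : Fin n => Set.Icc (0 : ℝ) 1),
            ∏ i : Fin n, eps ((2 : ℝ) ^ (k i (fun j => x j.1)) * x i)} := by
  have hub : ∀ p ∈ {p : ℝ | ∃ k : (i : Fin n) → (({j : Fin n // j ≠ i} → ℝ) → ℕ),
      (∀ i, Measurable (k i)) ∧ (∀ i x, 1 ≤ k i x) ∧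
      p = ∫ x in Set.univ.pi (fun _ : Fin n => Set.Icc (0 : ℝ) 1),
            ∏ i : Fin n, eps ((2 : ℝ) ^ (k i (fun j => x j.1)) * x i)}, p ≤ V := by
    rintro p ⟨k, hk, hk1, rfl⟩
    refine le_of_tendsto_of_tendsto (hatT_tendsto k hk) hV ?_
    filter_upwards [eventually_ge_atTop 1] with h hh
    exact hatT_int_le hh k hk hk1
  apply le_antisymm
  · refine le_of_tendsto hV ?_
    filter_upwards [eventually_ge_atTop 1] with h hh
    refine csSup_le ⟨_, fun _ _ => ⟨0, hh⟩, rfl⟩ ?_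
    rintro p ⟨k, rfl⟩
    obtain ⟨K, hK, hK1, e⟩ := finite_strategy k
    exact le_csSup ⟨V, hub⟩ ⟨K, hK, hK1, e⟩
  · exact csSup_le ⟨_, fun _ _ => 1, fun _ => measurable_const, fun _ _ => le_rfl, rfl⟩ hub
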